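/- arXiv:2212.09484 — 2 statements merged into one kernel-verified Lean document; each statement's English description precedes it below -/
import Mathlib

section
/- For a prime p and n ≥ 1, the number of subgroup chains of Z/p × Z/p^{n-1} ending at the whole group equals 2^{n-1}·(2 + (n-1)p). -/
/-- The number of nonempty chains of subgroups of `G` (under strict inclusion,
i.e. finite sets of subgroups that are totally ordered) whose largest element is `G` itself. -/
noncomputable def numChains (G : Type*) [Group G] : ℕ :=
  Nat.card {C : Finset (Subgroup G) //
    IsChain (· ≤ ·) (C : Set (Subgroup G)) ∧ (⊤ : Subgroup G) ∈ C}

/-- The finite chains of a preorder all of whose elements lie in `S`. -/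
def chainsIn {α : Type*} [LE α] (S : Set α) : Set (Finset α) :=
  {C | IsChain (· ≤ ·) (C : Set α) ∧ (C : Set α) ⊆ S}

section Order

variable {α β : Type*} [PartialOrder α] [PartialOrder β]

lemma chainsIn_mono {S T : Set α} (h : S ⊆ T) : chainsIn S ⊆ chainsIn T :=
  fun _ hC => ⟨hC.1, hC.2.trans h⟩

lemma ncard_chainsIn_empty : (chainsIn (∅ : Set α)).ncard = 1 := by
  have : chainsIn (∅ : Set α) = {∅} := by
    ext C
    simp only [chainsIn, Set.subset_empty_iff, Finset.coe_eq_empty, Set.mem_ofPred_eq,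
      Set.mem_singleton_iff, and_iff_right_iff_imp]
    rintro rfl
    simp
  simp [this]

lemma ncard_chainsIn_range (e : α ↪o β) :
    (chainsIn (Set.range e)).ncard = (chainsIn (Set.univ : Set α)).ncard := by
  rw [← Set.ncard_image_of_injective _ (Finset.map_injective e.toEmbedding)]
  congr 1
  ext C
  constructor
  · rintro ⟨hC, hCe⟩
    obtain ⟨D, rfl⟩ : ∃ D : Finset α, D.map e.toEmbedding = C := by
      classical
      obtain ⟨D, -, hD⟩ := Finset.subset_set_image_iff.1 (hCe.trans_eq Set.image_univ.symm)
      exact ⟨D, by rw [Finset.map_eq_image]; exact hD⟩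
    refine ⟨D, ⟨?_, Set.subset_univ _⟩, rfl⟩
    intro x hx y hy hxy
    simpa using hC (x := e x) (by simpa using hx) (y := e y) (by simpa using hy)
      (e.injective.ne hxy)
  · rintro ⟨D, ⟨hD, -⟩, rfl⟩
    refine ⟨?_, by simp⟩
    simp only [Finset.coe_map]
    rintro _ ⟨x, hx, rfl⟩ _ ⟨y, hy, rfl⟩ hxy
    simpa using hD hx hy (fun h => hxy (by rw [h]))

section OrderTop

variable [OrderTop α]

lemma ncard_chains_top :
    {C : Finset α | IsChain (· ≤ ·) (C : Set α) ∧ ⊤ ∈ C}.ncard =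
      (chainsIn (Set.Iio (⊤ : α))).ncard := by
  classical
  symm
  refine Set.ncard_congr (fun C _ => insert ⊤ C) ?_ ?_ ?_
  · rintro C ⟨hC, -⟩
    refine ⟨?_, Finset.mem_insert_self _ _⟩
    rw [Finset.coe_insert]
    exact hC.insert fun _ _ _ => Or.inr le_top
  · intro C D hC hD h
    have hC' : ⊤ ∉ C := fun h => lt_irrefl _ (hC.2 h)
    have hD' : ⊤ ∉ D := fun h => lt_irrefl _ (hD.2 h)
    rw [← Finset.erase_insert hC', ← Finset.erase_insert hD', h]
  · rintro C ⟨hC, hC'⟩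
    refine ⟨C.erase ⊤, ⟨hC.mono (by simp), ?_⟩, Finset.insert_erase hC'⟩
    intro x hx
    exact lt_top_iff_ne_top.2 (Finset.ne_of_mem_erase hx)

lemma ncard_chainsIn_univ [Finite α] :
    (chainsIn (Set.univ : Set α)).ncard = 2 * (chainsIn (Set.Iio (⊤ : α))).ncard := by
  have h : chainsIn (Set.univ : Set α) =
      {C : Finset α | IsChain (· ≤ ·) (C : Set α) ∧ ⊤ ∈ C} ∪ chainsIn (Set.Iio (⊤ : α)) := by
    ext C
    have : (C : Set α) ⊆ Set.Iio ⊤ ↔ ⊤ ∉ C :=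
      ⟨fun h h' => lt_irrefl _ (h h'),
        fun h x hx => lt_top_iff_ne_top.2 (fun hx' => h (hx' ▸ hx))⟩
    simp only [chainsIn, Set.mem_union, Set.mem_ofPred_eq, Set.subset_univ, this]
    tauto
  rw [h, Set.ncard_union_eq, ncard_chains_top, two_mul]
  rw [Set.disjoint_left]
  exact fun C hC hC' => lt_irrefl _ (hC'.2 hC.2)

/-- Counting the chains below `⊤` when the coatoms `M i` pairwise meet in `b`. -/
lemma ncard_chainsIn_Iio_top [Finite α] {ι : Type*} [Fintype ι] [Nonempty ι] (M : ι → α) (b : α)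
    (hcov : ∀ x < ⊤, ∃ i, x ≤ M i) (hM : ∀ i, M i < ⊤) (hb : ∀ i, b ≤ M i)
    (hinf : ∀ i j, i ≠ j → ∀ x, x ≤ M i → x ≤ M j → x ≤ b) :
    (chainsIn (Set.Iio (⊤ : α))).ncard + Fintype.card ι * (chainsIn (Set.Iic b)).ncard =
      (chainsIn (Set.Iic b)).ncard + ∑ i, (chainsIn (Set.Iic (M i))).ncard := by
  have hunion : chainsIn (Set.Iio (⊤ : α)) =
      chainsIn (Set.Iic b) ∪ ⋃ i, (chainsIn (Set.Iic (M i)) \ chainsIn (Set.Iic b)) := by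
    rw [← Set.iUnion_sdiff, Set.union_sdiff_self]
    refine Set.Subset.antisymm ?_ (Set.union_subset ?_ (Set.iUnion_subset fun i => ?_))
    · rintro C ⟨hC, hCt⟩
      right
      rw [Set.mem_iUnion]
      rcases C.eq_empty_or_nonempty with rfl | hne
      · exact ⟨Classical.arbitrary ι, hC, by simp⟩
      · obtain ⟨m, hm⟩ := C.exists_maximal hne
        obtain ⟨i, hi⟩ := hcov m (hCt hm.prop)
        refine ⟨i, hC, fun x hx => ?_⟩
        rcases hC.total hx hm.prop with h | h
        · exact h.trans hi
        · exact (hm.le_of_ge hx h).trans hi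
    · let i := Classical.arbitrary ι
      exact chainsIn_mono fun x hx => (le_trans hx (hb i)).trans_lt (hM i)
    · exact chainsIn_mono fun x hx => lt_of_le_of_lt hx (hM i)
  have hdisj : Pairwise (Function.onFun Disjoint
      fun i => chainsIn (Set.Iic (M i)) \ chainsIn (Set.Iic b)) := by
    intro i j hij
    refine Set.disjoint_left.2 ?_
    rintro C ⟨hi, hb⟩ ⟨hj, -⟩
    exact hb ⟨hi.1, fun x hx => hinf i j hij x (hi.2 hx) (hj.2 hx)⟩
  rw [hunion, Set.ncard_union_eq, Set.ncard_iUnion_of_finite (fun _ => Set.toFinite _) hdisj,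
    finsum_eq_sum_of_fintype, add_assoc, ← smul_eq_mul, ← Finset.card_univ, ← Finset.sum_const,
    ← Finset.sum_add_distrib]
  · congr 1
    refine Finset.sum_congr rfl fun i _ => Set.ncard_sdiff_add_ncard_of_subset ?_
    exact chainsIn_mono (Set.Iic_subset_Iic.2 (hb i))
  · rw [Set.disjoint_iUnion_right]
    exact fun i => Set.disjoint_sdiff_right

end OrderTop

end Order

section AddSubgroup

variable {A B : Type*} [AddGroup A] [AddGroup B]

lemma ncard_chainsIn_Iic_range (f : A →+ B) (hf : Function.Injective f) :
    (chainsIn (Set.Iic f.range)).ncard = (chainsIn (Set.univ : Set (AddSubgroup A))).ncard := by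
  let e : AddSubgroup A ↪o AddSubgroup B :=
    OrderEmbedding.ofMapLEIff (AddSubgroup.map f)
      fun _ _ => AddSubgroup.map_le_map_iff_of_injective hf
  rw [← ncard_chainsIn_range e]
  congr 2
  ext H
  constructor
  · exact fun h => ⟨H.comap f, AddSubgroup.map_comap_eq_self h⟩
  · rintro ⟨K, rfl⟩
    exact AddSubgroup.map_le_range f K

lemma ncard_chainsIn_univ_congr (f : A ≃+ B) :
    (chainsIn (Set.univ : Set (AddSubgroup A))).ncard =
      (chainsIn (Set.univ : Set (AddSubgroup B))).ncard := by
  rw [← ncard_chainsIn_Iic_range f.toAddMonoidHom f.injective,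
    AddMonoidHom.range_eq_top.2 f.surjective, Set.Iic_top]

lemma two_mul_numChains_multiplicative [Finite A] :
    2 * numChains (Multiplicative A) =
      (chainsIn (Set.univ : Set (AddSubgroup A))).ncard := by
  have h : numChains (Multiplicative A) =
      {C : Finset (Subgroup (Multiplicative A)) |
        IsChain (· ≤ ·) (C : Set (Subgroup (Multiplicative A))) ∧ ⊤ ∈ C}.ncard := rfl
  rw [h, ncard_chains_top, ← ncard_chainsIn_univ,
    ← ncard_chainsIn_range (AddSubgroup.toSubgroup (A := A)).toOrderEmbedding]
  congr 2
  exact (AddSubgroup.toSubgroup (A := A)).surjective.range_eq.symm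

end AddSubgroup

/-- Multiplication by `p`, as a homomorphism `ZMod (p ^ k) → ZMod (p ^ (k + 1))`. -/
def ZMod.mulPrimeHom (p k : ℕ) : ZMod (p ^ k) →+ ZMod (p ^ (k + 1)) :=
  ZMod.lift (p ^ k) ⟨(AddMonoidHom.mulLeft (p : ZMod (p ^ (k + 1)))).comp
    (Int.castAddHom (ZMod (p ^ (k + 1)))), by
      simpa [pow_succ'] using ZMod.natCast_self (p ^ (k + 1))⟩

/-- Reduction mod `p`, as a ring homomorphism `ZMod (p ^ (k + 1)) → ZMod p`. -/
def ZMod.redHom (p k : ℕ) : ZMod (p ^ (k + 1)) →+* ZMod p :=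
  ZMod.castHom (dvd_pow_self p k.succ_ne_zero) (ZMod p)

section ZMod

variable {p : ℕ} (k : ℕ)

lemma ZMod.mulPrimeHom_intCast (x : ℤ) :
    ZMod.mulPrimeHom p k (x : ZMod (p ^ k)) = (p : ZMod (p ^ (k + 1))) * x := by
  simp [ZMod.mulPrimeHom]

lemma ZMod.mulPrimeHom_injective (hp : p.Prime) : Function.Injective (ZMod.mulPrimeHom p k) := by
  rw [ZMod.mulPrimeHom, ZMod.lift_injective]
  intro m hm
  have h : (((p * m : ℤ)) : ZMod (p ^ (k + 1))) = 0 := by simpa using hm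
  rw [ZMod.intCast_zmod_eq_zero_iff_dvd] at h ⊢
  push_cast [pow_succ'] at h ⊢
  exact Int.dvd_of_mul_dvd_mul_left (by exact_mod_cast hp.ne_zero) h

lemma ZMod.mem_range_mulPrimeHom {x : ZMod (p ^ (k + 1))} :
    x ∈ (ZMod.mulPrimeHom p k).range ↔ ZMod.redHom p k x = 0 := by
  constructor
  · rintro ⟨y, rfl⟩
    obtain ⟨y, rfl⟩ := ZMod.intCast_surjective y
    rw [ZMod.mulPrimeHom_intCast]
    simp
  · obtain ⟨x, rfl⟩ := ZMod.intCast_surjective x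
    intro h
    rw [map_intCast, ZMod.intCast_zmod_eq_zero_iff_dvd] at h
    obtain ⟨y, rfl⟩ := h
    exact ⟨y, by simp [ZMod.mulPrimeHom_intCast]⟩

lemma ZMod.exists_zsmul_eq_one (hp : p.Prime) {x : ZMod (p ^ (k + 1))}
    (hx : ZMod.redHom p k x ≠ 0) : ∃ m : ℤ, m • x = 1 := by
  have : NeZero (p ^ (k + 1)) := ⟨pow_ne_zero _ hp.ne_zero⟩
  obtain ⟨n, rfl⟩ := ZMod.natCast_zmod_surjective x
  rw [map_natCast, Ne, ZMod.natCast_eq_zero_iff] at hx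
  obtain ⟨u, hu⟩ := (ZMod.isUnit_natCast_iff_not_dvd_pow hp k.succ_pos).2 hx
  obtain ⟨m, hm⟩ := ZMod.intCast_surjective ((u⁻¹ : (ZMod (p ^ (k + 1)))ˣ) : ZMod (p ^ (k + 1)))
  exact ⟨m, by rw [zsmul_eq_mul, hm, ← hu, Units.inv_mul]⟩

lemma ZMod.addSubgroup_eq_top_of_one_mem {n : ℕ} {H : AddSubgroup (ZMod n)} (h : 1 ∈ H) :
    H = ⊤ := by
  refine (AddSubgroup.eq_top_iff' H).2 fun x => ?_
  obtain ⟨m, rfl⟩ := ZMod.intCast_surjective x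
  simpa using H.zsmul_mem h m

lemma ncard_chainsIn_zmod_pow (hp : p.Prime) :
    (chainsIn (Set.univ : Set (AddSubgroup (ZMod (p ^ k))))).ncard = 2 ^ (k + 1) := by
  have : Fact p.Prime := ⟨hp⟩
  induction k with
  | zero =>
    have : Subsingleton (ZMod (p ^ 0)) := by
      rw [pow_zero]
      infer_instance
    have : Finite (ZMod (p ^ 0)) := Finite.of_subsingleton
    have h : Set.Iio (⊤ : AddSubgroup (ZMod (p ^ 0))) = ∅ := by
      refine Set.eq_empty_of_forall_notMem fun H hH => ?_
      exact (Set.mem_Iio.1 hH).ne (Subsingleton.elim H ⊤)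
    rw [ncard_chainsIn_univ, h, ncard_chainsIn_empty]
    norm_num
  | succ k ih =>
    have : NeZero (p ^ (k + 1)) := ⟨pow_ne_zero _ hp.ne_zero⟩
    have h : Set.Iio (⊤ : AddSubgroup (ZMod (p ^ (k + 1)))) =
        Set.Iic (ZMod.mulPrimeHom p k).range := by
      ext H
      rw [Set.mem_Iio, Set.mem_Iic]
      constructor
      · intro hH x hx
        rw [ZMod.mem_range_mulPrimeHom]
        by_contra hx'
        obtain ⟨m, hm⟩ := ZMod.exists_zsmul_eq_one k hp hx'
        exact hH.ne (ZMod.addSubgroup_eq_top_of_one_mem (hm ▸ H.zsmul_mem hx m))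
      · intro hH
        rw [lt_top_iff_ne_top]
        rintro rfl
        have := (ZMod.mem_range_mulPrimeHom (p := p) k).1 (hH (AddSubgroup.mem_top 1))
        simp at this
    rw [ncard_chainsIn_univ, h, ncard_chainsIn_Iic_range _ (ZMod.mulPrimeHom_injective k hp), ih,
      pow_succ' 2 (k + 1)]

/-- The homomorphism `x ↦ (c * x, x)` from `ZMod (p ^ (k + 1))`. -/
def ZMod.graphHom (p k : ℕ) (c : ZMod p) : ZMod (p ^ (k + 1)) →+ ZMod p × ZMod (p ^ (k + 1)) :=
  ((AddMonoidHom.mulLeft c).comp (ZMod.redHom p k).toAddMonoidHom).prod (AddMonoidHom.id _)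

lemma ZMod.graphHom_injective (c : ZMod p) : Function.Injective (ZMod.graphHom p k c) :=
  fun _ _ h => congrArg Prod.snd h

lemma ZMod.mem_range_graphHom {c : ZMod p} {x : ZMod p × ZMod (p ^ (k + 1))} :
    x ∈ (ZMod.graphHom p k c).range ↔ x.1 = c * ZMod.redHom p k x.2 := by
  constructor
  · rintro ⟨y, rfl⟩
    rfl
  · intro h
    exact ⟨x.2, Prod.ext h.symm rfl⟩

lemma ZMod.mem_range_prodMap_mulPrimeHom {x : ZMod p × ZMod (p ^ (k + 1))} :
    x ∈ ((AddMonoidHom.id (ZMod p)).prodMap (ZMod.mulPrimeHom p k)).range ↔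
      ZMod.redHom p k x.2 = 0 := by
  rw [← ZMod.mem_range_mulPrimeHom]
  constructor
  · rintro ⟨y, rfl⟩
    exact ⟨y.2, rfl⟩
  · rintro ⟨y, hy⟩
    exact ⟨(x.1, y), Prod.ext rfl hy⟩

lemma ZMod.mem_range_inr_comp_mulPrimeHom {x : ZMod p × ZMod (p ^ (k + 1))} :
    x ∈ ((AddMonoidHom.inr (ZMod p) (ZMod (p ^ (k + 1)))).comp (ZMod.mulPrimeHom p k)).range ↔
      x.1 = 0 ∧ ZMod.redHom p k x.2 = 0 := by
  rw [← ZMod.mem_range_mulPrimeHom]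
  constructor
  · rintro ⟨y, rfl⟩
    exact ⟨rfl, y, rfl⟩
  · rintro ⟨hx, y, hy⟩
    exact ⟨y, Prod.ext hx.symm hy⟩

/-- The maximal subgroups of `ZMod p × ZMod (p ^ (k + 1))`. -/
def ZMod.maxSubgroup (p k : ℕ) : Option (ZMod p) → AddSubgroup (ZMod p × ZMod (p ^ (k + 1)))
  | none => ((AddMonoidHom.id (ZMod p)).prodMap (ZMod.mulPrimeHom p k)).range
  | some c => (ZMod.graphHom p k c).range

lemma ZMod.exists_le_maxSubgroup (hp : p.Prime)
    {H : AddSubgroup (ZMod p × ZMod (p ^ (k + 1)))} (hH : H < ⊤) :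
    ∃ i, H ≤ ZMod.maxSubgroup p k i := by
  have : Fact p.Prime := ⟨hp⟩
  by_contra! hno
  obtain ⟨x, hx, hx'⟩ := SetLike.not_le_iff_exists.1 (hno none)
  rw [ZMod.maxSubgroup, ZMod.mem_range_prodMap_mulPrimeHom] at hx'
  obtain ⟨m, hm⟩ := ZMod.exists_zsmul_eq_one k hp hx'
  obtain ⟨c, hc⟩ : ∃ c, (c, 1) ∈ H := ⟨m • x.1, hm ▸ H.zsmul_mem hx m⟩
  obtain ⟨y, hy, hy'⟩ := SetLike.not_le_iff_exists.1 (hno (some c))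
  rw [ZMod.maxSubgroup, ZMod.mem_range_graphHom] at hy'
  have hmul : ∀ z : ZMod (p ^ (k + 1)), (c * ZMod.redHom p k z, z) ∈ H := by
    intro z
    obtain ⟨n, rfl⟩ := ZMod.intCast_surjective z
    simpa [mul_comm] using H.zsmul_mem hc n
  have hd : (y.1 - c * ZMod.redHom p k y.2, 0) ∈ H := by
    simpa only [Prod.mk_sub_mk, sub_self] using H.sub_mem (show (y.1, y.2) ∈ H from hy) (hmul y.2)
  have hd0 := sub_ne_zero.2 hy'
  have hfst : ∀ a : ZMod p, (a, 0) ∈ H := by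
    intro a
    obtain ⟨n, hn⟩ := ZMod.intCast_surjective (a * (y.1 - c * ZMod.redHom p k y.2)⁻¹)
    have h := H.zsmul_mem hd n
    rwa [Prod.smul_mk, zsmul_eq_mul, hn, smul_zero, inv_mul_cancel_right₀ hd0] at h
  refine hH.ne ((AddSubgroup.eq_top_iff' H).2 fun z => ?_)
  simpa using H.add_mem (hfst (z.1 - c * ZMod.redHom p k z.2)) (hmul z.2)

lemma ZMod.maxSubgroup_lt_top (hp : p.Prime) (i : Option (ZMod p)) :
    ZMod.maxSubgroup p k i < ⊤ := by
  have : Fact p.Prime := ⟨hp⟩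
  rw [lt_top_iff_ne_top]
  intro h
  cases i with
  | none =>
    have h1 : (0, 1) ∈ ZMod.maxSubgroup p k none := h ▸ AddSubgroup.mem_top _
    rw [ZMod.maxSubgroup, ZMod.mem_range_prodMap_mulPrimeHom] at h1
    simp at h1
  | some c =>
    have h1 : (1, 0) ∈ ZMod.maxSubgroup p k (some c) := h ▸ AddSubgroup.mem_top _
    rw [ZMod.maxSubgroup, ZMod.mem_range_graphHom] at h1
    simp at h1

lemma ZMod.range_inr_comp_mulPrimeHom_le (i : Option (ZMod p)) :
    ((AddMonoidHom.inr (ZMod p) (ZMod (p ^ (k + 1)))).comp (ZMod.mulPrimeHom p k)).range ≤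
      ZMod.maxSubgroup p k i := by
  intro x hx
  rw [ZMod.mem_range_inr_comp_mulPrimeHom] at hx
  cases i with
  | none => exact (ZMod.mem_range_prodMap_mulPrimeHom k).2 hx.2
  | some c => exact (ZMod.mem_range_graphHom k).2 (by rw [hx.1, hx.2, mul_zero])

lemma ZMod.maxSubgroup_inf_le (hp : p.Prime) {i j : Option (ZMod p)} (hij : i ≠ j) :
    ZMod.maxSubgroup p k i ⊓ ZMod.maxSubgroup p k j ≤
      ((AddMonoidHom.inr (ZMod p) (ZMod (p ^ (k + 1)))).comp (ZMod.mulPrimeHom p k)).range := by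
  have : Fact p.Prime := ⟨hp⟩
  rintro x ⟨hi, hj⟩
  rw [ZMod.mem_range_inr_comp_mulPrimeHom]
  cases i with
  | none =>
    cases j with
    | none => exact absurd rfl hij
    | some c =>
      have hi := (ZMod.mem_range_prodMap_mulPrimeHom k).1 hi
      have hj := (ZMod.mem_range_graphHom k).1 hj
      exact ⟨by rw [hj, hi, mul_zero], hi⟩
  | some c =>
    have hi := (ZMod.mem_range_graphHom k).1 hi
    cases j with
    | none =>
      have hj := (ZMod.mem_range_prodMap_mulPrimeHom k).1 hj
      exact ⟨by rw [hi, hj, mul_zero], hj⟩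
    | some d =>
      have hj := (ZMod.mem_range_graphHom k).1 hj
      have h0 : ZMod.redHom p k x.2 = 0 := by
        by_contra h0
        exact hij (congrArg some (mul_right_cancel₀ h0 (hi.symm.trans hj)))
      exact ⟨by rw [hi, h0, mul_zero], h0⟩

lemma ncard_chainsIn_zmod_prod (hp : p.Prime) :
    (chainsIn (Set.univ : Set (AddSubgroup (ZMod p × ZMod (p ^ k))))).ncard =
      2 ^ (k + 1) * (2 + k * p) := by
  have : Fact p.Prime := ⟨hp⟩
  induction k with
  | zero =>
    have : Unique (ZMod (p ^ 0)) := by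
      rw [pow_zero]
      infer_instance
    have h := ncard_chainsIn_zmod_pow 1 hp
    rw [pow_one] at h
    rw [ncard_chainsIn_univ_congr AddEquiv.prodUnique, h]
    norm_num
  | succ k ih =>
    have : NeZero (p ^ (k + 1)) := ⟨pow_ne_zero _ hp.ne_zero⟩
    have h := ncard_chainsIn_Iio_top (ZMod.maxSubgroup p k) _
      (fun H hH => ZMod.exists_le_maxSubgroup k hp hH) (ZMod.maxSubgroup_lt_top k hp)
      (ZMod.range_inr_comp_mulPrimeHom_le k)
      (fun i j hij H hi hj => (le_inf hi hj).trans (ZMod.maxSubgroup_inf_le k hp hij))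
    have hinr : Function.Injective
        ((AddMonoidHom.inr (ZMod p) (ZMod (p ^ (k + 1)))).comp (ZMod.mulPrimeHom p k)) :=
      fun _ _ h => ZMod.mulPrimeHom_injective k hp (congrArg Prod.snd h)
    have hprod : Function.Injective
        ((AddMonoidHom.id (ZMod p)).prodMap (ZMod.mulPrimeHom p k)) :=
      Function.injective_id.prodMap (ZMod.mulPrimeHom_injective k hp)
    simp only [Fintype.sum_option, ZMod.maxSubgroup, ncard_chainsIn_Iic_range _ hinr,
      ncard_chainsIn_Iic_range _ hprod,
      fun c => ncard_chainsIn_Iic_range _ (ZMod.graphHom_injective (p := p) k c), ih,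
      ncard_chainsIn_zmod_pow _ hp,
      Fintype.card_option, ZMod.card, Finset.sum_const, Finset.card_univ, smul_eq_mul] at h
    rw [ncard_chainsIn_univ]
    have h' : (chainsIn (Set.Iio (⊤ : AddSubgroup (ZMod p × ZMod (p ^ (k + 1)))))).ncard =
        2 ^ (k + 1) * (2 + (k + 1) * p) := by
      rw [pow_succ' 2 (k + 1)] at h
      linarith
    rw [h']
    ring

end ZMod

theorem numChains_zmod_p_mul_zmod_pow (p n : ℕ) (hp : p.Prime) (hn : 1 ≤ n) :
    numChains (Multiplicative (ZMod p × ZMod (p ^ (n - 1)))) =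
      2 ^ (n - 1) * (2 + (n - 1) * p) := by
  have : NeZero p := ⟨hp.ne_zero⟩
  have : NeZero (p ^ (n - 1)) := ⟨pow_ne_zero _ hp.ne_zero⟩
  refine Nat.eq_of_mul_eq_mul_left two_pos ?_
  rw [two_mul_numChains_multiplicative, ncard_chainsIn_zmod_prod _ hp, pow_succ', mul_assoc]
end

section
/- For n > 3, the number of subgroup chains of D_{2^n} × Z/2 ending at the whole group equals 2^{2n}·(2n + 1) − 2^{n+1}, where D_{2^n} is the dihedral group of order 2^n. -/
section Chains

open Classical in
/-- The chains of a finite partial order whose largest element is `x`. -/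
noncomputable def chainsTo {α : Type*} [PartialOrder α] [Fintype α] (x : α) :
    Finset (Finset α) :=
  {C | IsChain (· ≤ ·) (C : Set α) ∧ x ∈ C ∧ ∀ y ∈ C, y ≤ x}

theorem mem_chainsTo {α : Type*} [PartialOrder α] [Fintype α] {x : α} {C : Finset α} :
    C ∈ chainsTo x ↔ IsChain (· ≤ ·) (C : Set α) ∧ x ∈ C ∧ ∀ y ∈ C, y ≤ x := by
  simp [chainsTo]

open Classical in
theorem card_chainsTo {α : Type*} [PartialOrder α] [Fintype α] (x : α) :
    (chainsTo x).card = 1 + ∑ y with y < x, (chainsTo y).card := by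
  have hS : chainsTo x = Finset.image (insert x)
      (insert ∅ (Finset.biUnion {y | y < x} chainsTo)) := by
    ext C
    simp only [Finset.mem_image, Finset.mem_insert, Finset.mem_biUnion, Finset.mem_filter,
      Finset.mem_univ, true_and, mem_chainsTo]
    constructor
    · rintro ⟨hC, hx, hle⟩
      refine ⟨C.erase x, ?_, Finset.insert_erase hx⟩
      rcases (C.erase x).eq_empty_or_nonempty with h | h
      · exact Or.inl h
      · have hC' : IsChain (· ≤ ·) ((C.erase x : Finset α) : Set α) :=
          hC.mono (by simp)
        obtain ⟨y, hy⟩ := (C.erase x).exists_maximal h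
        have hyC := Finset.mem_erase.1 hy.1
        refine Or.inr ⟨y, (hle y hyC.2).lt_of_ne hyC.1, hC', hy.1, fun z hz => ?_⟩
        rcases hC'.total hy.1 hz with h | h
        · exact hy.2 hz h
        · exact h
    · rintro ⟨C', h | ⟨y, hyx, hC', hy, hle⟩, rfl⟩
      · subst h
        simp
      · refine ⟨?_, by simp, ?_⟩
        · rw [Finset.coe_insert]
          exact hC'.insert fun z hz _ => Or.inr ((hle z hz).trans hyx.le)
        · intro z hz
          rcases Finset.mem_insert.1 hz with rfl | hz
          · exact le_rfl
          · exact (hle z hz).trans hyx.le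
  have hnot : ∀ C ∈ insert ∅ (Finset.biUnion {y | y < x} chainsTo), x ∉ C := by
    intro C hC hx
    simp only [Finset.mem_insert, Finset.mem_biUnion, Finset.mem_filter, Finset.mem_univ,
      true_and, mem_chainsTo] at hC
    rcases hC with rfl | ⟨y, hyx, -, -, hle⟩
    · simp at hx
    · exact (hle x hx).not_gt hyx
  rw [hS, Finset.card_image_of_injOn, Finset.card_insert_of_notMem, Finset.card_biUnion, add_comm]
  · intro y _ z _ hyz
    refine Finset.disjoint_left.2 ?_
    intro C hy hz
    rw [mem_chainsTo] at hy hz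
    exact hyz (le_antisymm (hz.2.2 y hy.2.1) (hy.2.2 z hz.2.1))
  · simp [mem_chainsTo]
  · intro C hC C' hC' h
    rw [← Finset.erase_insert (hnot C hC), ← Finset.erase_insert (hnot C' hC')]
    exact congrArg (fun s => Finset.erase s x) h

theorem card_chainsTo_map {α β : Type*} [PartialOrder α] [Fintype α] [PartialOrder β] [Fintype β]
    (e : α ↪o β) (x : α) (he : ∀ y ≤ e x, y ∈ Set.range e) :
    (chainsTo (e x)).card = (chainsTo x).card := by
  classical
  symm
  refine Finset.card_bij (fun C _ => C.map e.toEmbedding) ?_ ?_ ?_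
  · intro C hC
    rw [mem_chainsTo] at hC ⊢
    refine ⟨?_, by simpa using hC.2.1, by simpa using hC.2.2⟩
    rw [Finset.coe_map]
    exact hC.1.image e
  · intro C _ C' _ h
    exact Finset.map_injective _ h
  · intro C hC
    rw [mem_chainsTo] at hC
    have hC' : (C.preimage e e.injective.injOn).map e.toEmbedding = C := by
      ext y
      simp only [Finset.mem_map, Finset.mem_preimage]
      constructor
      · rintro ⟨z, hz, rfl⟩
        exact hz
      · intro hy
        obtain ⟨z, rfl⟩ := he y (hC.2.2 y hy)
        exact ⟨z, hy, rfl⟩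
    refine ⟨C.preimage e e.injective.injOn, ?_, hC'⟩
    rw [mem_chainsTo]
    refine ⟨?_, by simpa using hC.2.1, fun y hy => ?_⟩
    · rw [Finset.coe_preimage]
      exact hC.1.preimage_relEmbedding e
    · exact e.le_iff_le.1 (hC.2.2 _ (Finset.mem_preimage.1 hy))

end Chains

section NumChains

theorem numChains_eq_card_chainsTo (G : Type*) [Group G] [Fintype (Subgroup G)] :
    numChains G = (chainsTo (⊤ : Subgroup G)).card := by
  rw [numChains, ← Nat.card_eq_finsetCard]
  exact Nat.card_congr (Equiv.subtypeEquivRight fun C => by simp [mem_chainsTo])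

theorem numChains_congr {G K : Type*} [Group G] [Group K] [Finite G] (e : G ≃* K) :
    numChains G = numChains K := by
  have : Finite K := Finite.of_equiv G e
  have := Fintype.ofFinite (Subgroup G)
  have := Fintype.ofFinite (Subgroup K)
  rw [numChains_eq_card_chainsTo, numChains_eq_card_chainsTo,
    ← card_chainsTo_map e.mapSubgroup.toOrderEmbedding ⊤ fun y _ => e.mapSubgroup.surjective y]
  simp

theorem numChains_coe {G : Type*} [Group G] [Finite G] [Fintype (Subgroup G)] (H : Subgroup G) :
    numChains H = (chainsTo H).card := by
  have := Fintype.ofFinite (Subgroup H)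
  let e : Subgroup H ↪o Subgroup G :=
    (Subgroup.MapSubtype.orderIso H).toOrderEmbedding.trans (OrderEmbedding.subtype _)
  have he : e ⊤ = H := (MonoidHom.range_eq_map H.subtype).symm.trans H.range_subtype
  rw [numChains_eq_card_chainsTo, ← card_chainsTo_map e ⊤, he]
  rw [he]
  intro y hy
  exact ⟨(Subgroup.MapSubtype.orderIso H).symm ⟨y, hy⟩, by simp [e, hy]⟩

theorem numChains_map {G K : Type*} [Group G] [Group K] [Finite G] {f : G →* K}
    (hf : Function.Injective f) (H : Subgroup G) : numChains (H.map f) = numChains H :=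
  (numChains_congr (H.equivMapOfInjective f hf)).symm

open Classical in
/-- A family of proper subgroups of a finite group `G` with integer weights, such that each proper
subgroup is contained in members of total weight `1`, computes the number of chains of `G`. -/
theorem numChains_eq_two_mul_sum {G ι : Type*} [Group G] [Finite G] [Nontrivial G] [Fintype ι]
    (M : ι → Subgroup G) (w c : ι → ℤ) (hM : ∀ i, M i ≠ ⊤)
    (hc : ∀ i, numChains (M i) = c i)
    (hw : ∀ H : Subgroup G, H ≠ ⊤ → ∑ i, w i * (if H ≤ M i then 1 else 0) = 1) :
    (numChains G : ℤ) = 2 * ∑ i, w i * c i := by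
  simp only [← hc]
  classical
  have := Fintype.ofFinite (Subgroup G)
  have hsum : ∀ K : Subgroup G,
      ∑ H : Subgroup G, ((chainsTo H).card : ℤ) * (if H ≤ K then 1 else 0) =
        2 * numChains K - 1 := by
    intro K
    have h : (Finset.univ.filter fun H : Subgroup G => H ≤ K) =
        insert K (Finset.univ.filter fun H => H < K) := by
      ext H
      simp [le_iff_eq_or_lt]
    have hK := congrArg (Nat.cast : ℕ → ℤ) (card_chainsTo K)
    push_cast at hK
    simp only [mul_ite, mul_one, mul_zero]
    rw [← Finset.sum_filter, h, Finset.sum_insert (by simp), numChains_coe]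
    linarith
  have hone : ∑ i, w i = 1 := by
    simpa using hw ⊥ bot_ne_top
  have htop := congrArg (Nat.cast : ℕ → ℤ) (card_chainsTo (⊤ : Subgroup G))
  push_cast at htop
  have hproper : ∑ H : Subgroup G with H < ⊤, ((chainsTo H).card : ℤ) =
      ∑ i, w i * (2 * numChains (M i) - 1) := by
    simp_rw [← hsum, Finset.mul_sum]
    rw [Finset.sum_comm, Finset.sum_filter]
    refine Finset.sum_congr rfl fun H _ => ?_
    by_cases hH : H = ⊤
    · subst hH
      simp [top_le_iff, hM]
    · rw [if_pos (lt_top_iff_ne_top.2 hH)]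
      calc ((chainsTo H).card : ℤ)
          = (chainsTo H).card * ∑ i, w i * (if H ≤ M i then 1 else 0) := by rw [hw H hH, mul_one]
        _ = _ := by
          rw [Finset.mul_sum]
          exact Finset.sum_congr rfl fun i _ => by ring
  rw [numChains_eq_card_chainsTo, htop, hproper]
  simp only [mul_sub, Finset.sum_sub_distrib, mul_one, hone, Finset.mul_sum]
  rw [add_sub_cancel]
  exact Finset.sum_congr rfl fun i _ => by ring

end NumChains

section Characters

local notation "C₂" => Multiplicative (ZMod 2)

theorem C2_eq_one_or (c : C₂) : c = 1 ∨ c = Multiplicative.ofAdd 1 := by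
  revert c
  decide

theorem C2_mul_self (c : C₂) : c * c = 1 := by
  revert c
  decide

theorem exists_le_ker_of_ne_top {G : Type*} [Group G] {m : ℕ} (hG : Nat.card G = 2 ^ m)
    {H : Subgroup G} (hH : H ≠ ⊤) : ∃ χ : G →* C₂, χ ≠ 1 ∧ H ≤ χ.ker := by
  have : Finite G := Nat.finite_of_card_ne_zero (by simp [hG])
  have : Fact (Nat.Prime 2) := ⟨Nat.prime_two⟩
  obtain ⟨n, hn, hHn⟩ := (Nat.dvd_prime_pow Nat.prime_two).1 (hG ▸ H.card_subgroup_dvd_card)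
  have hnm : n < m := by
    refine hn.lt_of_ne ?_
    rintro rfl
    exact hH (H.eq_top_of_card_eq (hHn.trans hG.symm))
  obtain ⟨K, hK, hHK⟩ := Sylow.exists_subgroup_card_pow_prime_le 2
    (hG ▸ pow_dvd_pow 2 (Nat.sub_le m 1)) H hHn (Nat.le_sub_one_of_lt hnm)
  have hKi : K.index = 2 := by
    have h := K.card_mul_index
    rw [hK, hG, ← Nat.sub_add_cancel (Nat.one_le_of_lt hnm), pow_succ, Nat.add_sub_cancel] at h
    exact Nat.eq_of_mul_eq_mul_left (by positivity) h
  have : K.Normal := Subgroup.normal_of_index_eq_two hKi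
  let e : G ⧸ K ≃* C₂ := mulEquivOfPrimeCardEq (p := 2) hKi (by simp)
  have hker : (e.toMonoidHom.comp (QuotientGroup.mk' K)).ker = K := by
    ext x
    simp
  refine ⟨e.toMonoidHom.comp (QuotientGroup.mk' K), fun h => ?_, hker.symm ▸ hHK⟩
  rw [h, MonoidHom.ker_one] at hker
  rw [← hker, Subgroup.index_top] at hKi
  exact absurd hKi (by decide)

variable {D : Type*} [Group D]

theorem hom_mul_self (χ : D →* C₂) : χ * χ = 1 := by
  ext x : 1
  exact C2_mul_self _

theorem hom_mul_mul_cancel_left (χ ψ : D →* C₂) : χ * (χ * ψ) = ψ := by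
  rw [← mul_assoc, hom_mul_self, one_mul]

theorem hom_mul_mul_cancel_right (χ ψ : D →* C₂) : χ * ψ * ψ = χ := by
  rw [mul_assoc, hom_mul_self, mul_one]

theorem le_ker_mul {H : Subgroup D} {χ ψ : D →* C₂} (hχ : H ≤ χ.ker) (hψ : H ≤ ψ.ker) :
    H ≤ (χ * ψ).ker := by
  intro x hx
  have h₁ := hχ hx
  have h₂ := hψ hx
  rw [MonoidHom.mem_ker] at *
  simp [h₁, h₂]

/-- The graph in `D × C₂` of the restriction of `χ` to `S`. -/
def graphOn (χ : D →* C₂) (S : Subgroup D) : Subgroup (D × C₂) :=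
  S.map ((MonoidHom.id D).prod χ)

theorem mem_graphOn {χ : D →* C₂} {S : Subgroup D} {x : D × C₂} :
    x ∈ graphOn χ S ↔ x.1 ∈ S ∧ x.2 = χ x.1 := by
  rcases x with ⟨g, c⟩
  simp only [graphOn, Subgroup.mem_map, MonoidHom.prod_apply, MonoidHom.id_apply, Prod.mk.injEq]
  constructor
  · rintro ⟨y, hy, rfl, rfl⟩
    exact ⟨hy, rfl⟩
  · rintro ⟨hg, rfl⟩
    exact ⟨g, hg, rfl, rfl⟩

theorem graphOn_ne_top (χ : D →* C₂) (S : Subgroup D) : graphOn χ S ≠ ⊤ := by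
  intro h
  have h1 : ((1, Multiplicative.ofAdd 1) : D × C₂) ∈ graphOn χ S := h ▸ Subgroup.mem_top _
  have h2 := (mem_graphOn.1 h1).2
  simp only [map_one χ] at h2
  exact absurd h2 (by decide)

theorem numChains_graphOn [Finite D] (χ : D →* C₂) (S : Subgroup D) :
    numChains (graphOn χ S) = numChains S :=
  numChains_map (fun x y h => by simpa using congrArg Prod.fst h) S

theorem numChains_graphOn_top [Finite D] (χ : D →* C₂) :
    numChains (graphOn χ ⊤) = numChains D :=
  (numChains_graphOn χ ⊤).trans (numChains_congr Subgroup.topEquiv)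

theorem numChains_prod_top [Finite D] (S : Subgroup D) :
    numChains (S.prod (⊤ : Subgroup C₂)) = numChains (S × C₂) :=
  numChains_congr ((S.prodEquiv ⊤).trans ((MulEquiv.refl S).prodCongr Subgroup.topEquiv))

theorem prod_top_ne_top {S : Subgroup D} (hS : S ≠ ⊤) : S.prod (⊤ : Subgroup C₂) ≠ ⊤ := by
  intro h
  refine hS (top_le_iff.1 fun x _ => ?_)
  have hx : ((x, 1) : D × C₂) ∈ S.prod ⊤ := h ▸ Subgroup.mem_top _
  exact (Subgroup.mem_prod.1 hx).1

theorem le_graphOn_iff {H : Subgroup (D × C₂)} {χ ψ : D →* C₂} :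
    H ≤ graphOn χ ψ.ker ↔ H ≤ graphOn χ ⊤ ∧ H ≤ ψ.ker.prod ⊤ := by
  simp only [SetLike.le_def, mem_graphOn, Subgroup.mem_prod]
  grind [Subgroup.mem_top]

theorem le_graphOn_mul {H : Subgroup (D × C₂)} {χ ψ : D →* C₂}
    (h₁ : H ≤ graphOn χ ⊤) (h₂ : H ≤ ψ.ker.prod ⊤) : H ≤ graphOn (χ * ψ) ⊤ := by
  intro x hx
  have h₃ := mem_graphOn.1 (h₁ hx)
  have h₄ := (Subgroup.mem_prod.1 (h₂ hx)).1
  rw [MonoidHom.mem_ker] at h₄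
  exact mem_graphOn.2 ⟨trivial, by simp [h₃.2, h₄]⟩

theorem le_prod_top_of_le_graphOn {H : Subgroup (D × C₂)} {χ ψ : D →* C₂}
    (h₁ : H ≤ graphOn χ ⊤) (h₂ : H ≤ graphOn ψ ⊤) : H ≤ (χ * ψ).ker.prod ⊤ := by
  intro x hx
  have h₃ := (mem_graphOn.1 (h₁ hx)).2
  have h₄ := (mem_graphOn.1 (h₂ hx)).2
  refine Subgroup.mem_prod.2 ⟨?_, trivial⟩
  rw [MonoidHom.mem_ker, MonoidHom.mul_apply, ← h₃, ← h₄, C2_mul_self]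

theorem le_prod_top_mul {H : Subgroup (D × C₂)} {χ ψ : D →* C₂}
    (h₁ : H ≤ χ.ker.prod ⊤) (h₂ : H ≤ ψ.ker.prod ⊤) : H ≤ (χ * ψ).ker.prod ⊤ := by
  intro x hx
  have h₃ := MonoidHom.mem_ker.1 (Subgroup.mem_prod.1 (h₁ hx)).1
  have h₄ := MonoidHom.mem_ker.1 (Subgroup.mem_prod.1 (h₂ hx)).1
  exact Subgroup.mem_prod.2 ⟨by rw [MonoidHom.mem_ker]; simp [h₃, h₄], trivial⟩

theorem le_inf_prod_top_iff {H : Subgroup (D × C₂)} {χ ψ : D →* C₂} :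
    H ≤ (χ.ker ⊓ ψ.ker).prod ⊤ ↔ H ≤ χ.ker.prod ⊤ ∧ H ≤ ψ.ker.prod ⊤ := by
  simp only [SetLike.le_def, Subgroup.mem_prod, Subgroup.mem_inf]
  grind

theorem exists_le_graphOn_or_le_prod {m : ℕ} (hD : Nat.card D = 2 ^ m)
    {H : Subgroup (D × C₂)} (hH : H ≠ ⊤) :
    ∃ χ : D →* C₂, H ≤ graphOn χ ⊤ ∨ χ ≠ 1 ∧ H ≤ χ.ker.prod ⊤ := by
  obtain ⟨χ, hχ, hHχ⟩ := exists_le_ker_of_ne_top (m := m + 1) (by simp [hD, pow_succ]) hH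
  have hsplit (x : D × C₂) : χ x = χ (x.1, 1) * χ (1, x.2) := by
    rw [← map_mul]
    simp
  refine ⟨χ.comp (MonoidHom.inl D C₂), ?_⟩
  rcases C2_eq_one_or (χ (1, Multiplicative.ofAdd 1)) with h | h
  · have h2 (c : C₂) : χ (1, c) = 1 := by
      rcases C2_eq_one_or c with rfl | rfl
      · exact map_one χ
      · exact h
    refine Or.inr ⟨fun h1 => hχ ?_, fun x hx => ?_⟩
    · ext x : 1
      rw [hsplit, h2]
      simpa using DFunLike.congr_fun h1 x.1
    · have hx := hHχ hx
      rw [MonoidHom.mem_ker, hsplit, h2, mul_one] at hx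
      exact Subgroup.mem_prod.2 ⟨by simpa [MonoidHom.mem_ker] using hx, trivial⟩
  · have h2 (c : C₂) : χ (1, c) = c := by
      rcases C2_eq_one_or c with rfl | rfl
      · exact map_one χ
      · exact h
    refine Or.inl fun x hx => mem_graphOn.2 ⟨trivial, ?_⟩
    have hx := hHχ hx
    rw [MonoidHom.mem_ker, hsplit, h2] at hx
    have := congrArg (· * x.2) hx
    simpa [mul_assoc, C2_mul_self] using this.symm

theorem numChains_of_hom_unique {m : ℕ} (hD : Nat.card D = 2 ^ m) {α : D →* C₂}
    (hα : α ≠ 1) (h : ∀ χ : D →* C₂, χ = 1 ∨ χ = α) :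
    (numChains D : ℤ) = 2 * numChains α.ker := by
  have : Finite D := Nat.finite_of_card_ne_zero (by simp [hD])
  have hne : α.ker ≠ ⊤ := by rwa [Ne, MonoidHom.ker_eq_top_iff]
  have : Nontrivial D := by
    by_contra hn
    rw [not_nontrivial_iff_subsingleton] at hn
    exact hne (Subsingleton.elim _ _)
  rw [numChains_eq_two_mul_sum (fun _ : Unit => α.ker) 1 (fun _ => numChains α.ker)
    (fun _ => hne) (fun _ => rfl)]
  · simp
  · intro H hH
    obtain ⟨χ, hχ, hHχ⟩ := exists_le_ker_of_ne_top hD hH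
    rcases h χ with rfl | rfl
    · exact absurd rfl hχ
    · simp [hHχ]

theorem numChains_prod_of_hom_unique {m : ℕ} (hD : Nat.card D = 2 ^ m) {α : D →* C₂}
    (hα : α ≠ 1) (h : ∀ χ : D →* C₂, χ = 1 ∨ χ = α) :
    (numChains (D × C₂) : ℤ) =
      2 * (2 * numChains D + numChains (α.ker × C₂) - 2 * numChains α.ker) := by
  classical
  have : Finite D := Nat.finite_of_card_ne_zero (by simp [hD])
  have hne : α.ker ≠ ⊤ := by rwa [Ne, MonoidHom.ker_eq_top_iff]
  rw [numChains_eq_two_mul_sum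
    ![graphOn 1 ⊤, graphOn α ⊤, α.ker.prod ⊤, graphOn 1 α.ker] ![1, 1, 1, -2]
    ![numChains D, numChains D, numChains (α.ker × C₂), numChains α.ker]]
  · simp [Fin.sum_univ_succ]
    ring
  · intro i
    fin_cases i
    exacts [graphOn_ne_top _ _, graphOn_ne_top _ _, prod_top_ne_top hne, graphOn_ne_top _ _]
  · intro i
    fin_cases i
    exacts [congrArg _ (numChains_graphOn_top _), congrArg _ (numChains_graphOn_top _),
      congrArg _ (numChains_prod_top _), congrArg _ (numChains_graphOn _ _)]
  · intro H hH
    simp only [Fin.sum_univ_succ]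
    simp only [Matrix.cons_val_zero, Matrix.cons_val_succ, Finset.univ_eq_empty, Finset.sum_empty,
      le_graphOn_iff]
    have h1 := @le_graphOn_mul D _ H 1 α
    have h2 := @le_prod_top_of_le_graphOn D _ H 1 α
    have h3 := @le_graphOn_mul D _ H α α
    rw [one_mul] at h1 h2
    rw [hom_mul_self] at h3
    have h5 : H ≤ graphOn 1 ⊤ ∨ H ≤ graphOn α ⊤ ∨ H ≤ α.ker.prod ⊤ := by
      obtain ⟨χ, hχ⟩ := exists_le_graphOn_or_le_prod hD hH
      rcases h χ with rfl | rfl <;> tauto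
    grind

theorem numChains_of_hom_pair {m : ℕ} (hD : Nat.card D = 2 ^ m) {α β : D →* C₂}
    (hα : α ≠ 1) (hβ : β ≠ 1) (hαβ : α * β ≠ 1)
    (h : ∀ χ : D →* C₂, χ = 1 ∨ χ = α ∨ χ = β ∨ χ = α * β) :
    (numChains D : ℤ) = 2 * (numChains α.ker + numChains β.ker + numChains (α * β).ker -
      2 * numChains (α.ker ⊓ β.ker : Subgroup D)) := by
  classical
  have : Finite D := Nat.finite_of_card_ne_zero (by simp [hD])
  have hne {χ : D →* C₂} (hχ : χ ≠ 1) : χ.ker ≠ ⊤ := by rwa [Ne, MonoidHom.ker_eq_top_iff]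
  have : Nontrivial D := by
    by_contra hn
    rw [not_nontrivial_iff_subsingleton] at hn
    exact hne hα (Subsingleton.elim _ _)
  rw [numChains_eq_two_mul_sum ![α.ker, β.ker, (α * β).ker, α.ker ⊓ β.ker] ![1, 1, 1, -2]
    ![numChains α.ker, numChains β.ker, numChains (α * β).ker,
      numChains (α.ker ⊓ β.ker : Subgroup D)]]
  · simp [Fin.sum_univ_succ]
    ring
  · intro i
    fin_cases i
    exacts [hne hα, hne hβ, hne hαβ, fun h' => hne hα (inf_eq_top_iff.1 h').1]
  · intro i
    fin_cases i <;> rfl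
  · intro H hH
    simp only [Fin.sum_univ_succ]
    simp only [Matrix.cons_val_zero, Matrix.cons_val_succ, Finset.univ_eq_empty, Finset.sum_empty,
      le_inf_iff]
    have h1 := @le_ker_mul D _ H α β
    have h2 := @le_ker_mul D _ H α (α * β)
    have h3 := @le_ker_mul D _ H (α * β) β
    rw [hom_mul_mul_cancel_left] at h2
    rw [hom_mul_mul_cancel_right] at h3
    have h4 : H ≤ α.ker ∨ H ≤ β.ker ∨ H ≤ (α * β).ker := by
      obtain ⟨χ, hχ, hHχ⟩ := exists_le_ker_of_ne_top hD hH
      rcases h χ with rfl | rfl | rfl | rfl <;> tauto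
    grind

open Classical in
theorem weight_sum_eq_one {g₀ g₁ g₂ g₃ p₁ p₂ p₃ : Prop}
    (h₀₁ : g₀ → p₁ → g₁) (h₀₂ : g₀ → p₂ → g₂) (h₀₃ : g₀ → p₃ → g₃)
    (h₁₂ : g₁ → p₂ → g₃) (h₁₁ : g₁ → p₁ → g₀) (h₂₂ : g₂ → p₂ → g₀)
    (h₁₃ : g₁ → p₃ → g₂) (h₂₁ : g₂ → p₁ → g₃) (h₂₃ : g₂ → p₃ → g₁) (h₃₁ : g₃ → p₁ → g₂)
    (h₃₂ : g₃ → p₂ → g₁) (h₃₃ : g₃ → p₃ → g₀)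
    (k₀₁ : g₀ → g₁ → p₁) (k₀₂ : g₀ → g₂ → p₂) (k₀₃ : g₀ → g₃ → p₃)
    (k₁₂ : g₁ → g₂ → p₃) (k₁₃ : g₁ → g₃ → p₂) (k₃₂ : g₃ → g₂ → p₁)
    (l₁₂ : p₁ → p₂ → p₃) (l₁₃ : p₁ → p₃ → p₂) (l₃₂ : p₃ → p₂ → p₁)
    (h : g₀ ∨ g₁ ∨ g₂ ∨ g₃ ∨ p₁ ∨ p₂ ∨ p₃) :
    ((if g₀ then 1 else 0) + ((if g₁ then 1 else 0) + ((if g₂ then 1 else 0) +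
      ((if g₃ then 1 else 0) + ((if p₁ then 1 else 0) + ((if p₂ then 1 else 0) +
      ((if p₃ then 1 else 0) + (-2 * (if g₀ ∧ p₁ then 1 else 0) +
      (-2 * (if g₀ ∧ p₂ then 1 else 0) + (-2 * (if g₀ ∧ p₃ then 1 else 0) +
      (-2 * (if g₂ ∧ p₁ then 1 else 0) + (-2 * (if g₁ ∧ p₂ then 1 else 0) +
      (-2 * (if g₁ ∧ p₃ then 1 else 0) + (-2 * (if p₁ ∧ p₂ then 1 else 0) +
      8 * (if g₀ ∧ p₁ ∧ p₂ then 1 else 0)))))))))))))) : ℤ) = 1 := by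
  by_cases g₀ <;> by_cases g₁ <;> by_cases g₂ <;> by_cases g₃ <;> by_cases p₁ <;>
    by_cases p₂ <;> by_cases p₃ <;> simp_all

theorem numChains_prod_of_hom_pair {m : ℕ} (hD : Nat.card D = 2 ^ m) {α β : D →* C₂}
    (hα : α ≠ 1) (hβ : β ≠ 1) (hαβ : α * β ≠ 1)
    (h : ∀ χ : D →* C₂, χ = 1 ∨ χ = α ∨ χ = β ∨ χ = α * β) :
    (numChains (D × C₂) : ℤ) = 2 * (4 * numChains D + numChains (α.ker × C₂) +
      numChains (β.ker × C₂) + numChains ((α * β).ker × C₂) -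
      2 * (2 * numChains α.ker + 2 * numChains β.ker + 2 * numChains (α * β).ker +
        numChains ((α.ker ⊓ β.ker : Subgroup D) × C₂)) +
      8 * numChains (α.ker ⊓ β.ker : Subgroup D)) := by
  classical
  have : Finite D := Nat.finite_of_card_ne_zero (by simp [hD])
  have hne {χ : D →* C₂} (hχ : χ ≠ 1) : χ.ker ≠ ⊤ := by rwa [Ne, MonoidHom.ker_eq_top_iff]
  have hle {H : Subgroup (D × C₂)} : H ≤ graphOn 1 (α.ker ⊓ β.ker) ↔
      H ≤ graphOn 1 ⊤ ∧ H ≤ α.ker.prod ⊤ ∧ H ≤ β.ker.prod ⊤ := by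
    rw [← le_inf_prod_top_iff]
    simp only [SetLike.le_def, mem_graphOn, Subgroup.mem_prod]
    grind [Subgroup.mem_top]
  rw [numChains_eq_two_mul_sum
    ![graphOn 1 ⊤, graphOn α ⊤, graphOn β ⊤, graphOn (α * β) ⊤,
      α.ker.prod ⊤, β.ker.prod ⊤, (α * β).ker.prod ⊤,
      graphOn 1 α.ker, graphOn 1 β.ker, graphOn 1 (α * β).ker,
      graphOn β α.ker, graphOn α β.ker, graphOn α (α * β).ker,
      (α.ker ⊓ β.ker).prod ⊤, graphOn 1 (α.ker ⊓ β.ker)]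
    ![1, 1, 1, 1, 1, 1, 1, -2, -2, -2, -2, -2, -2, -2, 8]
    ![numChains D, numChains D, numChains D, numChains D,
      numChains (α.ker × C₂), numChains (β.ker × C₂), numChains ((α * β).ker × C₂),
      numChains α.ker, numChains β.ker, numChains (α * β).ker,
      numChains α.ker, numChains β.ker, numChains (α * β).ker,
      numChains ((α.ker ⊓ β.ker : Subgroup D) × C₂), numChains (α.ker ⊓ β.ker : Subgroup D)]]
  · simp [Fin.sum_univ_succ]
    ring
  · intro i
    fin_cases i
    exacts [graphOn_ne_top _ _, graphOn_ne_top _ _, graphOn_ne_top _ _, graphOn_ne_top _ _,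
      prod_top_ne_top (hne hα), prod_top_ne_top (hne hβ), prod_top_ne_top (hne hαβ),
      graphOn_ne_top _ _, graphOn_ne_top _ _, graphOn_ne_top _ _,
      graphOn_ne_top _ _, graphOn_ne_top _ _, graphOn_ne_top _ _,
      prod_top_ne_top fun h' => hne hα (inf_eq_top_iff.1 h').1, graphOn_ne_top _ _]
  · intro i
    fin_cases i
    exacts [congrArg _ (numChains_graphOn_top _), congrArg _ (numChains_graphOn_top _),
      congrArg _ (numChains_graphOn_top _), congrArg _ (numChains_graphOn_top _),
      congrArg _ (numChains_prod_top _), congrArg _ (numChains_prod_top _),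
      congrArg _ (numChains_prod_top _), congrArg _ (numChains_graphOn _ _),
      congrArg _ (numChains_graphOn _ _), congrArg _ (numChains_graphOn _ _),
      congrArg _ (numChains_graphOn _ _), congrArg _ (numChains_graphOn _ _),
      congrArg _ (numChains_graphOn _ _), congrArg _ (numChains_prod_top _),
      congrArg _ (numChains_graphOn _ _)]
  · intro H hH
    have h0 : H ≤ graphOn 1 ⊤ ∨ H ≤ graphOn α ⊤ ∨ H ≤ graphOn β ⊤ ∨ H ≤ graphOn (α * β) ⊤ ∨
        H ≤ α.ker.prod ⊤ ∨ H ≤ β.ker.prod ⊤ ∨ H ≤ (α * β).ker.prod ⊤ := by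
      obtain ⟨χ, hχ⟩ := exists_le_graphOn_or_le_prod hD hH
      rcases h χ with rfl | rfl | rfl | rfl <;> tauto
    simp only [Fin.sum_univ_succ]
    simp only [Matrix.cons_val_zero, Matrix.cons_val_succ, Finset.univ_eq_empty, Finset.sum_empty,
      hle, le_graphOn_iff, le_inf_prod_top_iff]
    have h1 := @le_graphOn_mul D _ H 1 α
    have h2 := @le_graphOn_mul D _ H 1 β
    have h3 := @le_graphOn_mul D _ H α β
    have h4 := @le_graphOn_mul D _ H α α
    have h5 := @le_graphOn_mul D _ H β β
    have h6 := @le_graphOn_mul D _ H (α * β) β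
    have h7 := @le_graphOn_mul D _ H α (α * β)
    have h10 := @le_graphOn_mul D _ H β α
    have h11 := @le_graphOn_mul D _ H β (α * β)
    have h12 := @le_graphOn_mul D _ H (α * β) α
    have h8 := @le_graphOn_mul D _ H 1 (α * β)
    have h9 := @le_graphOn_mul D _ H (α * β) (α * β)
    have k1 := @le_prod_top_of_le_graphOn D _ H 1 α
    have k2 := @le_prod_top_of_le_graphOn D _ H 1 β
    have k3 := @le_prod_top_of_le_graphOn D _ H 1 (α * β)
    have k4 := @le_prod_top_of_le_graphOn D _ H α β
    have k5 := @le_prod_top_of_le_graphOn D _ H α (α * β)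
    have k6 := @le_prod_top_of_le_graphOn D _ H (α * β) β
    have l1 := @le_prod_top_mul D _ H α β
    have l2 := @le_prod_top_mul D _ H α (α * β)
    have l3 := @le_prod_top_mul D _ H (α * β) β
    rw [mul_comm β α] at h10
    rw [mul_left_comm, hom_mul_self, mul_one] at h11
    rw [mul_comm (α * β) α, hom_mul_mul_cancel_left] at h12
    simp only [one_mul, hom_mul_mul_cancel_left, hom_mul_mul_cancel_right, hom_mul_self]
      at h1 h2 h3 h4 h5 h6 h7 h8 h9 k1 k2 k3 k4 k5 k6 l1 l2 l3
    simp only [one_mul, add_zero]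
    exact weight_sum_eq_one h1 h2 h8 h3 h4 h5 h7 h10 h11 h12 h6 h9 k1 k2 k3 k4 k5 k6 l1 l2 l3 h0

theorem zmod_hom_apply {n : ℕ} [NeZero n] {K : Type*} [Group K] (f : Multiplicative (ZMod n) →* K)
    (i : ZMod n) : f (Multiplicative.ofAdd i) = f (Multiplicative.ofAdd 1) ^ i.val := by
  rw [← map_pow, ← ofAdd_nsmul, nsmul_one, ZMod.natCast_rightInverse i]

/-- Doubling, as an embedding of `ZMod (2 ^ k)` into `ZMod (2 ^ (k + 1))`. -/
def double (k : ℕ) : ZMod (2 ^ k) →+ ZMod (2 ^ (k + 1)) :=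
  ZMod.lift (2 ^ k) ⟨(AddMonoidHom.mulLeft 2).comp (Int.castAddHom _), by
    have h := ZMod.natCast_self (2 ^ (k + 1))
    push_cast at h
    simpa [pow_succ'] using h⟩

theorem double_intCast (k : ℕ) (x : ℤ) : double k x = 2 * x := by
  simp [double]

theorem double_injective (k : ℕ) : Function.Injective (double k) := by
  rw [double, ZMod.lift_injective]
  intro m hm
  have h : ((2 * m : ℤ) : ZMod (2 ^ (k + 1))) = 0 := by simpa using hm
  rw [ZMod.intCast_zmod_eq_zero_iff_dvd] at h ⊢
  push_cast [pow_succ'] at h ⊢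
  exact Int.dvd_of_mul_dvd_mul_left two_ne_zero h

/-- Reduction modulo `2`. -/
def parity (k : ℕ) : ZMod (2 ^ (k + 1)) →+* ZMod 2 :=
  ZMod.castHom (dvd_pow_self 2 k.succ_ne_zero) (ZMod 2)

theorem parity_eq_zero_iff {k : ℕ} {i : ZMod (2 ^ (k + 1))} :
    parity k i = 0 ↔ ∃ j, double k j = i := by
  constructor
  · obtain ⟨x, rfl⟩ := ZMod.intCast_surjective i
    rw [map_intCast, ZMod.intCast_zmod_eq_zero_iff_dvd]
    rintro ⟨y, rfl⟩
    exact ⟨y, by rw [double_intCast]; push_cast; rfl⟩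
  · rintro ⟨j, rfl⟩
    obtain ⟨x, rfl⟩ := ZMod.intCast_surjective j
    rw [double_intCast, map_mul, map_ofNat, show (OfNat.ofNat 2 : ZMod 2) = 0 from rfl, zero_mul]

theorem numChains_of_range_eq {G K : Type*} [Group G] [Group K] [Finite K] {f : K →* G}
    (hf : Function.Injective f) {H : Subgroup G} (hH : f.range = H) :
    numChains H = numChains K ∧ numChains (H × C₂) = numChains (K × C₂) := by
  subst hH
  have e := MonoidHom.ofInjective hf
  exact ⟨(numChains_congr e).symm, (numChains_congr (e.prodCongr (MulEquiv.refl C₂))).symm⟩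

section Cyclic

/-- The nontrivial character of order two of the cyclic group of order `2 ^ (k + 1)`. -/
def cyclicParity (k : ℕ) : Multiplicative (ZMod (2 ^ (k + 1))) →* C₂ :=
  (parity k).toAddMonoidHom.toMultiplicative

theorem cyclicParity_ne_one (k : ℕ) : cyclicParity k ≠ 1 := by
  intro h
  have h1 := DFunLike.congr_fun h (Multiplicative.ofAdd 1)
  have h2 : parity k 1 = 0 := h1
  rw [map_one] at h2
  exact absurd h2 (by decide)

theorem eq_one_or_eq_cyclicParity {k : ℕ} (χ : Multiplicative (ZMod (2 ^ (k + 1))) →* C₂) :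
    χ = 1 ∨ χ = cyclicParity k := by
  have hα : cyclicParity k (Multiplicative.ofAdd 1) = Multiplicative.ofAdd 1 :=
    congrArg Multiplicative.ofAdd (map_one (parity k))
  have hext {ψ : Multiplicative (ZMod (2 ^ (k + 1))) →* C₂}
      (h : χ (Multiplicative.ofAdd 1) = ψ (Multiplicative.ofAdd 1)) : χ = ψ := by
    refine MonoidHom.ext fun i => ?_
    induction i with | ofAdd i => rw [zmod_hom_apply χ, zmod_hom_apply ψ, h]
  rcases C2_eq_one_or (χ (Multiplicative.ofAdd 1)) with h | h
  · exact Or.inl (hext h)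
  · exact Or.inr (hext (h.trans hα.symm))

theorem numChains_ker_cyclicParity (k : ℕ) :
    numChains (cyclicParity k).ker = numChains (Multiplicative (ZMod (2 ^ k))) ∧
    numChains ((cyclicParity k).ker × C₂) = numChains (Multiplicative (ZMod (2 ^ k)) × C₂) := by
  refine numChains_of_range_eq (f := (double k).toMultiplicative) (double_injective k) ?_
  ext i
  exact parity_eq_zero_iff.symm

theorem numChains_of_card_eq_one {G : Type*} [Group G] (hG : Nat.card G = 1) : numChains G = 1 := by
  have : Subsingleton G := (Nat.card_eq_one_iff_unique.1 hG).1
  have := Fintype.ofFinite (Subgroup G)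
  rw [numChains_eq_card_chainsTo, card_chainsTo, Finset.sum_eq_zero, add_zero]
  intro H hH
  simp [Subsingleton.elim H ⊤] at hH

theorem numChains_zmod (k : ℕ) : numChains (Multiplicative (ZMod (2 ^ k))) = 2 ^ k := by
  induction k with
  | zero => exact numChains_of_card_eq_one (by simp)
  | succ k ih =>
    have h := numChains_of_hom_unique (m := k + 1) (by simp) (cyclicParity_ne_one k)
      eq_one_or_eq_cyclicParity
    rw [(numChains_ker_cyclicParity k).1, ih] at h
    zify
    rw [h, pow_succ']
    rfl

theorem numChains_C2 : numChains C₂ = 2 := numChains_zmod 1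

theorem numChains_unique_prod {G K : Type*} [Group G] [Group K] [Unique G] [Finite K] :
    numChains (G × K) = numChains K :=
  have : Finite (G × K) := inferInstance
  numChains_congr MulEquiv.uniqueProd

theorem numChains_zmod_prod (k : ℕ) :
    numChains (Multiplicative (ZMod (2 ^ k)) × C₂) = 2 ^ k * (2 * k + 2) := by
  induction k with
  | zero =>
    have : Unique (Multiplicative (ZMod (2 ^ 0))) := inferInstanceAs (Unique (Fin 1))
    rw [numChains_unique_prod, numChains_C2]
    rfl
  | succ k ih =>
    have h := numChains_prod_of_hom_unique (m := k + 1) (by simp) (cyclicParity_ne_one k)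
      eq_one_or_eq_cyclicParity
    rw [(numChains_ker_cyclicParity k).1, (numChains_ker_cyclicParity k).2, ih, numChains_zmod,
      numChains_zmod] at h
    zify
    rw [h]
    push_cast
    ring

end Cyclic

section Dihedral

open DihedralGroup

/-- The character of the dihedral group whose value at `r i` and at `sr i` is the parity of `i`. -/
def dihedralParity (k : ℕ) : DihedralGroup (2 ^ (k + 1)) →* C₂ :=
  MonoidHom.mk' (fun
    | r i => Multiplicative.ofAdd (parity k i)
    | sr i => Multiplicative.ofAdd (parity k i)) <| by
    have hsub (a b : ZMod 2) : b - a = a + b := by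
      revert a b
      decide
    rintro (i | i) (j | j) <;> simp [← ofAdd_add, hsub]

/-- The character of the dihedral group that detects reflections. -/
def dihedralSign (n : ℕ) : DihedralGroup n →* C₂ :=
  MonoidHom.mk' (fun
    | r _ => 1
    | sr _ => Multiplicative.ofAdd 1) <| by
    rintro (i | i) (j | j) <;> simp [C2_mul_self]

/-- The inclusion of the rotations in the dihedral group. -/
def rotationHom (n : ℕ) : Multiplicative (ZMod n) →* DihedralGroup n :=
  MonoidHom.mk' (fun i => r i.toAdd) fun i j => by simp

/-- The embedding of a dihedral group in the dihedral group of twice its order that maps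
`r i` to `r (2 * i)` and `sr i` to `sr (2 * i + a)`. -/
def dihedralDouble (k : ℕ) (a : ZMod (2 ^ (k + 1))) :
    DihedralGroup (2 ^ k) →* DihedralGroup (2 ^ (k + 1)) :=
  MonoidHom.mk' (fun
    | r i => r (double k i)
    | sr i => sr (double k i + a)) <| by
    rintro (i | i) (j | j) <;> simp <;> ring

@[simp]
theorem dihedralParity_r {k : ℕ} (i : ZMod (2 ^ (k + 1))) :
    dihedralParity k (r i) = Multiplicative.ofAdd (parity k i) := rfl

@[simp]
theorem dihedralParity_sr {k : ℕ} (i : ZMod (2 ^ (k + 1))) :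
    dihedralParity k (sr i) = Multiplicative.ofAdd (parity k i) := rfl

@[simp]
theorem dihedralSign_r {n : ℕ} (i : ZMod n) : dihedralSign n (r i) = 1 := rfl

@[simp]
theorem dihedralSign_sr {n : ℕ} (i : ZMod n) :
    dihedralSign n (sr i) = Multiplicative.ofAdd 1 := rfl

@[simp]
theorem rotationHom_apply {n : ℕ} (i : Multiplicative (ZMod n)) : rotationHom n i = r i.toAdd := rfl

@[simp]
theorem dihedralDouble_r {k : ℕ} (a : ZMod (2 ^ (k + 1))) (i : ZMod (2 ^ k)) :
    dihedralDouble k a (r i) = r (double k i) := rfl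

@[simp]
theorem dihedralDouble_sr {k : ℕ} (a : ZMod (2 ^ (k + 1))) (i : ZMod (2 ^ k)) :
    dihedralDouble k a (sr i) = sr (double k i + a) := rfl

theorem rotationHom_injective (n : ℕ) : Function.Injective (rotationHom n) := by
  intro i j h
  simpa using h

theorem dihedralDouble_injective (k : ℕ) (a : ZMod (2 ^ (k + 1))) :
    Function.Injective (dihedralDouble k a) := by
  rintro (i | i) (j | j) h <;> simp_all [(double_injective k).eq_iff]

theorem dihedral_hom_ext {n : ℕ} [NeZero n] {K : Type*} [Group K] {f g : DihedralGroup n →* K}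
    (hr : f (r 1) = g (r 1)) (hsr : f (sr 0) = g (sr 0)) : f = g := by
  have h (i : ZMod n) : f (r i) = g (r i) := by
    rw [← ZMod.natCast_rightInverse i, ← one_mul ((_ : ℕ) : ZMod n), ← r_pow, map_pow, map_pow, hr]
  ext (i | i)
  · exact h i
  · rw [← zero_add i, ← sr_mul_r, map_mul, map_mul, hsr, h]

theorem dihedral_hom_cases {k : ℕ} (χ : DihedralGroup (2 ^ (k + 1)) →* C₂) :
    χ = 1 ∨ χ = dihedralParity k ∨ χ = dihedralSign _ ∨
      χ = dihedralParity k * dihedralSign _ := by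
  rcases C2_eq_one_or (χ (r 1)) with h₁ | h₁ <;> rcases C2_eq_one_or (χ (sr 0)) with h₂ | h₂
  · exact Or.inl (dihedral_hom_ext h₁ h₂)
  · exact Or.inr (Or.inr (Or.inl (dihedral_hom_ext h₁ h₂)))
  · exact Or.inr (Or.inl (dihedral_hom_ext (by simp [h₁]) (by simp [h₂])))
  · exact Or.inr (Or.inr (Or.inr (dihedral_hom_ext (by simp [h₁]) (by simp [h₂]))))

theorem dihedralParity_ne_one (k : ℕ) : dihedralParity k ≠ 1 := by
  intro h
  simpa using DFunLike.congr_fun h (r 1)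

theorem dihedralSign_ne_one (n : ℕ) : dihedralSign n ≠ 1 := by
  intro h
  simpa using DFunLike.congr_fun h (sr 0)

theorem dihedralParity_mul_dihedralSign_ne_one (k : ℕ) :
    dihedralParity k * dihedralSign _ ≠ 1 := by
  intro h
  simpa using DFunLike.congr_fun h (r 1)

theorem range_dihedralDouble_zero (k : ℕ) :
    (dihedralDouble k 0).range = (dihedralParity k).ker := by
  ext x
  rw [MonoidHom.mem_range, MonoidHom.mem_ker]
  constructor
  · rintro ⟨i | i, rfl⟩ <;> simp [parity_eq_zero_iff]
  · rcases x with i | i <;> intro h <;> obtain ⟨j, rfl⟩ := parity_eq_zero_iff.1 h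
    exacts [⟨r j, rfl⟩, ⟨sr j, by simp⟩]

theorem range_dihedralDouble_one (k : ℕ) :
    (dihedralDouble k 1).range = (dihedralParity k * dihedralSign _).ker := by
  have hd (j : ZMod (2 ^ k)) : parity k (double k j) = 0 := parity_eq_zero_iff.2 ⟨j, rfl⟩
  ext x
  rw [MonoidHom.mem_range, MonoidHom.mem_ker]
  constructor
  · rintro ⟨i | i, rfl⟩ <;> simp [hd, C2_mul_self]
  · rcases x with i | i <;> intro h
    · obtain ⟨j, rfl⟩ := parity_eq_zero_iff.1 (show parity k i = 0 by simpa using h)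
      exact ⟨r j, rfl⟩
    · have h' : parity k (i - 1) = 0 := by
        have h1 : parity k i + 1 = 0 := h
        have h2 (a : ZMod 2) (ha : a + 1 = 0) : a - 1 = 0 := by
          revert a
          decide
        rw [map_sub, map_one, h2 _ h1]
      obtain ⟨j, hj⟩ := parity_eq_zero_iff.1 h'
      exact ⟨sr j, by simp [hj]⟩

theorem range_rotationHom (n : ℕ) : (rotationHom n).range = (dihedralSign n).ker := by
  ext x
  rw [MonoidHom.mem_range, MonoidHom.mem_ker]
  rcases x with i | i <;> simp

theorem range_rotationHom_comp_double (k : ℕ) :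
    ((rotationHom _).comp (double k).toMultiplicative).range =
      (dihedralParity k).ker ⊓ (dihedralSign _).ker := by
  ext x
  rw [MonoidHom.mem_range, Subgroup.mem_inf, MonoidHom.mem_ker, MonoidHom.mem_ker]
  rcases x with i | i <;> simp [parity_eq_zero_iff]

theorem card_dihedral (k : ℕ) : Nat.card (DihedralGroup (2 ^ k)) = 2 ^ (k + 1) := by
  rw [DihedralGroup.nat_card, pow_succ']

theorem numChains_dihedral (k : ℕ) : numChains (DihedralGroup (2 ^ k)) = 2 ^ (2 * k + 1) := by
  induction k with
  | zero =>
    have e : DihedralGroup (2 ^ 0) ≃* C₂ :=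
      mulEquivOfPrimeCardEq (p := 2) (card_dihedral 0) (by simp)
    rw [numChains_congr e, numChains_C2]
    rfl
  | succ k ih =>
    have h := numChains_of_hom_pair (card_dihedral (k + 1)) (dihedralParity_ne_one k)
      (dihedralSign_ne_one _) (dihedralParity_mul_dihedralSign_ne_one k) dihedral_hom_cases
    rw [(numChains_of_range_eq (dihedralDouble_injective k 0) (range_dihedralDouble_zero k)).1,
      (numChains_of_range_eq (dihedralDouble_injective k 1) (range_dihedralDouble_one k)).1,
      (numChains_of_range_eq (rotationHom_injective _) (range_rotationHom _)).1,
      (numChains_of_range_eq ((rotationHom_injective _).comp (double_injective k))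
        (range_rotationHom_comp_double k)).1, ih, numChains_zmod, numChains_zmod] at h
    zify
    rw [h]
    push_cast
    ring

theorem numChains_dihedral_prod (k : ℕ) :
    (numChains (DihedralGroup (2 ^ k) × C₂) : ℤ) = 4 ^ (k + 1) * (2 * k + 3) - 2 ^ (k + 2) := by
  induction k with
  | zero =>
    have e : DihedralGroup (2 ^ 0) ≃* Multiplicative (ZMod (2 ^ 1)) :=
      mulEquivOfPrimeCardEq (p := 2) (card_dihedral 0) (by simp)
    rw [numChains_congr (e.prodCongr (MulEquiv.refl C₂)), numChains_zmod_prod]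
    norm_num
  | succ k ih =>
    have h := numChains_prod_of_hom_pair (card_dihedral (k + 1)) (dihedralParity_ne_one k)
      (dihedralSign_ne_one _) (dihedralParity_mul_dihedralSign_ne_one k) dihedral_hom_cases
    have h₁ := numChains_of_range_eq (dihedralDouble_injective k 0) (range_dihedralDouble_zero k)
    have h₂ := numChains_of_range_eq (rotationHom_injective _) (range_rotationHom (2 ^ (k + 1)))
    have h₃ := numChains_of_range_eq (dihedralDouble_injective k 1) (range_dihedralDouble_one k)
    have h₄ := numChains_of_range_eq ((rotationHom_injective _).comp (double_injective k))
      (range_rotationHom_comp_double k)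
    rw [h₁.1, h₁.2, h₂.1, h₂.2, h₃.1, h₃.2, h₄.1, h₄.2, ih] at h
    simp only [numChains_zmod, numChains_zmod_prod, numChains_dihedral] at h
    rw [h]
    push_cast
    have h2 : (2 : ℤ) ^ (2 * k) = 4 ^ k := by rw [pow_mul]; norm_num
    simp only [mul_add, pow_add, h2]
    ring

end Dihedral

end Characters

theorem numChains_dihedral_mul_C2 (n : ℕ) (hn : 3 < n) :
    numChains (DihedralGroup (2 ^ (n - 1)) × Multiplicative (ZMod 2)) =
      2 ^ (2 * n) * (2 * n + 1) - 2 ^ (n + 1) := by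
  obtain ⟨k, rfl⟩ : ∃ k, n = k + 1 := ⟨n - 1, by omega⟩
  have h := numChains_dihedral_prod k
  rw [Nat.add_sub_cancel]
  refine Nat.eq_sub_of_add_eq ?_
  rw [pow_mul]
  zify
  rw [h]
  push_cast
  ring
end
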